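/- arXiv:1908.09408 — 4 statements merged into one kernel-verified Lean document; each statement's English description precedes it below -/
import Mathlib

section
/- Let m > n₁ ≥ n₂ ≥ 1 be integers and let ω: (0,∞) → [0,∞) be measurable with 0 < Mω(n₁+j−n₂+1) < ∞ for all j = 0,…,n₂−1. Let a ∈ ℝ^{n₂} have pairwise distinct nonzero entries. For j = 0,…,n₂−1 define q_j^≥(ã) = ( (m+j−n₂)! / ((m−n₁)!(n₁+j−n₂)!·Mω(n₁+j−n₂+1)) ) · ∑_{c=1}^{n₂} ( (−1)^{n₂−j−1} e_{n₂−j−1}(a_{≠c}) / ∏_{h≠c}(a_c − a_h) ) · ω̃_≥(ã | a_c). Then the bi-orthonormality relation ∫_ℝ ã^i · q_j^≥(ã) dã = δ_{ij} holds for all 0 ≤ i, j ≤ n₂−1, where δ_{ij} is the Kronecker delta. -/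
open MeasureTheory Finset Filter Set

noncomputable section

namespace RMT

/-- The elementary symmetric polynomial `e_k(a_{≠c})` of the entries of `a` with `a c` removed. -/
def esymmErase {n : ℕ} (a : Fin n → ℝ) (c : Fin n) (k : ℕ) : ℝ :=
  ∑ T ∈ Finset.powersetCard k (Finset.univ.erase c), ∏ i ∈ T, a i

/-- The Vandermonde determinant `Δ_n(a) = ∏_{c>d} (a_c - a_d)`. -/
def VdmF {n : ℕ} (a : Fin n → ℝ) : ℝ := ∏ c : Fin n, ∏ d ∈ Finset.Iio c, (a c - a d)

/-- The Mellin transform `Mω(j) = ∫_0^∞ x^{j-1} ω(x) dx` at a positive integer `j`. -/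
def MellinNat (ω : ℝ → ℝ) (j : ℕ) : ℝ := ∫ x in Set.Ioi (0 : ℝ), x ^ (j - 1) * ω x

/-- The weight `ω̃_≥(ã|a)` (for `m > n₁ ≥ n₂`). -/
def omegaTildeGe (m n₁ n₂ : ℕ) (ω : ℝ → ℝ) (t av : ℝ) : ℝ :=
  (if 0 < t * av then 1 else 0) * (t / av) ^ (n₁ - n₂) *
    ∫ u in Set.Ioo (0 : ℝ) 1,
      (((m - n₁ : ℕ) : ℝ) * (1 - u) ^ (m - n₁ - 1) * ω (t / (av * u))) / (|av| * u)

end RMT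

namespace RMT

/-- The bi-orthonormal functions `q_j^≥` built from the weight `ω̃_≥`. -/
def qGe (m n₁ n₂ : ℕ) (ω : ℝ → ℝ) (a : Fin n₂ → ℝ) (j : ℕ) (t : ℝ) : ℝ :=
  ((Nat.factorial (m + j - n₂) : ℝ) /
      ((Nat.factorial (m - n₁) : ℝ) * (Nat.factorial (n₁ + j - n₂) : ℝ) *
        MellinNat ω (n₁ + j - n₂ + 1))) *
    ∑ c : Fin n₂,
      ((-1 : ℝ) ^ (n₂ - j - 1) * esymmErase a c (n₂ - j - 1) /
          ∏ h ∈ Finset.univ.erase c, (a c - a h)) *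
        omegaTildeGe m n₁ n₂ ω t (a c)

/-- The Beta integral at natural-number arguments. -/
theorem beta_nat (q : ℕ) : ∀ N : ℕ, (∫ u in (0:ℝ)..1, u ^ N * (1 - u) ^ q) =
    (N.factorial : ℝ) * q.factorial / (N + q + 1).factorial := by
  induction q with
  | zero =>
    intro N
    simp only [pow_zero, mul_one, integral_pow, Nat.factorial_zero, Nat.cast_one, add_zero,
      Nat.factorial_succ]
    have := Nat.factorial_pos N
    push_cast
    field_simp
    simp
  | succ q ih =>
    intro N
    have key := intervalIntegral.integral_mul_deriv_eq_deriv_mul (a := (0:ℝ)) (b := 1)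
      (u := fun x : ℝ => (1 - x) ^ (q + 1)) (u' := fun x : ℝ => -((q + 1 : ℝ) * (1 - x) ^ q))
      (v := fun x : ℝ => x ^ (N + 1) / (N + 1)) (v' := fun x : ℝ => x ^ N)
      (fun x _ => by
        have h := ((hasDerivAt_id x).const_sub 1).pow (q + 1)
        convert h using 1
        · ext y
          simp
        · simp)
      (fun x _ => by
        have h := (hasDerivAt_pow (N + 1) x).div_const ((N : ℝ) + 1)
        convert h using 1
        have : (N : ℝ) + 1 ≠ 0 := by positivity
        push_cast
        field_simp
        try simp)
      (Continuous.intervalIntegrable (by fun_prop) _ _)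
      (Continuous.intervalIntegrable (by fun_prop) _ _)
    have e1 : (∫ u in (0:ℝ)..1, u ^ N * (1 - u) ^ (q + 1)) =
        ∫ u in (0:ℝ)..1, (1 - u) ^ (q + 1) * u ^ N := by
      congr 1; ext u; ring
    have e2 : (∫ x in (0:ℝ)..1, -((q + 1 : ℝ) * (1 - x) ^ q) * (x ^ (N + 1) / (N + 1))) =
        -((q + 1 : ℝ) / (N + 1)) * ∫ u in (0:ℝ)..1, u ^ (N + 1) * (1 - u) ^ q := by
      rw [← intervalIntegral.integral_const_mul]
      congr 1; ext u; ring
    rw [e1, key, e2, ih (N + 1)]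
    have hp := Nat.factorial_pos (N + 1 + q + 1)
    have : N + (q + 1) + 1 = N + 1 + q + 1 := by ring
    rw [this, Nat.factorial_succ N, Nat.factorial_succ q]
    push_cast
    have : (N : ℝ) + 1 ≠ 0 := by positivity
    have : (((N + 1 + q + 1).factorial : ℕ) : ℝ) ≠ 0 := by positivity
    field_simp
    simp

theorem beta_nat_Ioo (N q : ℕ) : (∫ u in Set.Ioo (0:ℝ) 1, u ^ N * (1 - u) ^ q) =
    (N.factorial : ℝ) * q.factorial / (N + q + 1).factorial := by
  rw [← beta_nat, intervalIntegral.integral_of_le zero_le_one, integral_Ioc_eq_integral_Ioo]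

/-- The inner weight. -/
def Gw (p : ℕ) (ω : ℝ → ℝ) (x : ℝ) : ℝ :=
  ∫ u in Set.Ioo (0 : ℝ) 1, ((p : ℝ) * (1 - u) ^ (p - 1) * ω (x / u)) / u

theorem Gw_moment (p N : ℕ) (hp : 1 ≤ p) (ω : ℝ → ℝ) (hm : Measurable ω)
    (hnn : ∀ x ∈ Set.Ioi (0 : ℝ), 0 ≤ ω x)
    (hωN : IntegrableOn (fun x => x ^ N * ω x) (Set.Ioi 0)) :
    IntegrableOn (fun x => x ^ N * Gw p ω x) (Set.Ioi 0) ∧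
    (∫ x in Set.Ioi (0:ℝ), x ^ N * Gw p ω x) =
      (∫ x in Set.Ioi (0:ℝ), x ^ N * ω x) *
        ((p.factorial : ℝ) * N.factorial / (p + N).factorial) := by
  set I := ∫ x in Set.Ioi (0:ℝ), x ^ N * ω x with hI
  let f : ℝ → ℝ → ℝ := fun u x => x ^ N * (((p : ℝ) * (1 - u) ^ (p - 1) * ω (x / u)) / u)
  have hfm : Measurable (Function.uncurry f) := by
    simp only [f, Function.uncurry_def]
    fun_prop
  have hfe : ∀ u : ℝ, u ≠ 0 → f u = fun x => (p * (1 - u) ^ (p - 1) * u ^ N / u) *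
      ((u⁻¹ * x) ^ N * ω (u⁻¹ * x)) := by
    intro u hu
    ext x
    simp only [f]
    rw [mul_pow, inv_pow, div_eq_inv_mul x u]
    field_simp
  have hfi : ∀ u ∈ Set.Ioo (0:ℝ) 1, IntegrableOn (f u) (Set.Ioi 0) := by
    intro u hu
    rw [hfe u hu.1.ne']
    apply Integrable.const_mul
    have := (integrableOn_Ioi_comp_mul_left_iff (fun x => x ^ N * ω x) 0
      (inv_pos.2 hu.1)).2 (by simpa using hωN)
    exact this
  have hfv : ∀ u ∈ Set.Ioo (0:ℝ) 1, (∫ x in Set.Ioi (0:ℝ), f u x) =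
      (p * I) * (u ^ N * (1 - u) ^ (p - 1)) := by
    intro u hu
    rw [hfe u hu.1.ne', integral_const_mul,
      integral_comp_mul_left_Ioi (fun x => x ^ N * ω x) 0 (inv_pos.2 hu.1)]
    have := hu.1.ne'
    simp only [mul_zero, smul_eq_mul, inv_inv, ← hI]
    field_simp
  have hfn : ∀ u ∈ Set.Ioo (0:ℝ) 1, ∀ x ∈ Set.Ioi (0:ℝ), 0 ≤ f u x := by
    intro u hu x hx
    have h1 : 0 < u := hu.1
    have h2 : 0 ≤ 1 - u := by linarith [hu.2]
    have h3 : 0 < x := hx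
    have h4 := hnn (x / u) (div_pos h3 h1)
    simp only [f]
    positivity
  have hpoly : IntegrableOn (fun u : ℝ => (p * I) * (u ^ N * (1 - u) ^ (p - 1)))
      (Set.Ioo 0 1) := by
    have : Continuous (fun u : ℝ => (p * I) * (u ^ N * (1 - u) ^ (p - 1))) := by fun_prop
    exact (this.integrableOn_Icc (a := 0) (b := 1)).mono_set Set.Ioo_subset_Icc_self
  have hprod : Integrable (Function.uncurry f)
      ((volume.restrict (Set.Ioo (0:ℝ) 1)).prod (volume.restrict (Set.Ioi (0:ℝ)))) := by
    rw [integrable_prod_iff hfm.aestronglyMeasurable]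
    constructor
    · filter_upwards [ae_restrict_mem measurableSet_Ioo] with u hu
      exact hfi u hu
    · refine hpoly.congr_fun (fun u hu => ?_) measurableSet_Ioo
      beta_reduce
      rw [← hfv u hu]
      refine setIntegral_congr_fun measurableSet_Ioi (fun x hx => ?_)
      exact (Real.norm_of_nonneg (hfn u hu x hx)).symm
  have hG : ∀ x, (∫ u in Set.Ioo (0:ℝ) 1, f u x) = x ^ N * Gw p ω x := by
    intro x
    simp only [f, Gw]
    rw [integral_const_mul]
  constructor
  · have := hprod.integral_prod_right
    simp only [Function.uncurry, hG] at this
    exact this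
  · have hsw := integral_integral_swap hprod
    simp only [hG] at hsw
    rw [← hsw, setIntegral_congr_fun measurableSet_Ioo hfv, integral_const_mul, beta_nat_Ioo]
    obtain ⟨q, rfl⟩ : ∃ q, p = q + 1 := ⟨p - 1, by omega⟩
    rw [show N + (q + 1 - 1) + 1 = q + 1 + N by omega, Nat.add_sub_cancel, Nat.factorial_succ q]
    push_cast
    ring

theorem omega_moment (m n₁ n₂ i : ℕ) (hm : n₁ < m) (h21 : n₂ ≤ n₁)
    (ω : ℝ → ℝ) (hωmeas : Measurable ω) (hωnn : ∀ x ∈ Set.Ioi (0 : ℝ), 0 ≤ ω x)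
    (hωN : IntegrableOn (fun x => x ^ (n₁ + i - n₂) * ω x) (Set.Ioi 0)) (av : ℝ) (hav : av ≠ 0) :
    Integrable (fun t => t ^ i * omegaTildeGe m n₁ n₂ ω t av) ∧
    (∫ t : ℝ, t ^ i * omegaTildeGe m n₁ n₂ ω t av) = av ^ i *
      ((∫ x in Set.Ioi (0:ℝ), x ^ (n₁ + i - n₂) * ω x) *
        (((m - n₁).factorial : ℝ) * (n₁ + i - n₂).factorial / (m + i - n₂).factorial)) := by
  obtain ⟨g1, g2⟩ := Gw_moment (m - n₁) (n₁ + i - n₂) (by omega) ω hωmeas hωnn hωN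
  rw [show m - n₁ + (n₁ + i - n₂) = m + i - n₂ by omega] at g2
  let F : ℝ → ℝ := fun x => (av ^ i / |av|) *
    (Set.Ioi (0:ℝ)).indicator (fun x => x ^ (n₁ + i - n₂) * Gw (m - n₁) ω x) x
  have hF : (fun t => t ^ i * omegaTildeGe m n₁ n₂ ω t av) = fun t => F (t / av) := by
    ext t
    have hiff : 0 < t * av ↔ 0 < t / av := by
      rw [mul_pos_iff, div_pos_iff]
    simp only [F, omegaTildeGe, Set.indicator_apply, Set.mem_Ioi, ← hiff]
    split_ifs with h
    · have hG : (∫ u in Set.Ioo (0 : ℝ) 1, (((m - n₁ : ℕ) : ℝ) * (1 - u) ^ (m - n₁ - 1) *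
          ω (t / (av * u))) / (|av| * u)) = |av|⁻¹ * Gw (m - n₁) ω (t / av) := by
        rw [Gw, ← integral_const_mul]
        congr 1; ext u
        rw [div_div]
        simp only [div_eq_mul_inv, mul_inv]
        ring
      rw [hG, show n₁ + i - n₂ = i + (n₁ - n₂) by omega, pow_add, div_pow t av i]
      field_simp
    · simp
  have hFi : Integrable F :=
    (((integrable_indicator_iff measurableSet_Ioi).2 g1)).const_mul _
  rw [hF]
  refine ⟨hFi.comp_div hav, ?_⟩
  rw [Measure.integral_comp_div, integral_const_mul, integral_indicator measurableSet_Ioi, g2,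
    smul_eq_mul]
  have := abs_pos.2 hav
  field_simp

theorem lagrange_delta {n : ℕ} (a : Fin n → ℝ) (hadist : Function.Injective a) (i j : ℕ)
    (hi : i < n) (hj : j < n) :
    ∑ c : Fin n, ((-1 : ℝ) ^ (n - j - 1) * esymmErase a c (n - j - 1) /
          ∏ h ∈ Finset.univ.erase c, (a c - a h)) * a c ^ i = if i = j then 1 else 0 := by
  have h := Lagrange.eq_interpolate (s := (Finset.univ : Finset (Fin n))) (v := a)
    (f := (Polynomial.X : Polynomial ℝ) ^ i) hadist.injOn
    (by simpa using hi)
  have h' := congrArg (fun P => Polynomial.coeff P j) h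
  simp only [Polynomial.coeff_X_pow, Lagrange.interpolate_apply, Polynomial.finsetSum_coeff,
    Polynomial.coeff_C_mul, Polynomial.eval_pow, Polynomial.eval_X] at h'
  rw [show (if i = j then (1:ℝ) else 0) = if j = i then 1 else 0 by simp only [eq_comm], h']
  refine Finset.sum_congr rfl (fun c _ => ?_)
  rw [mul_comm]
  congr 1
  have hb : Lagrange.basis Finset.univ a c =
      Polynomial.C (∏ h ∈ Finset.univ.erase c, (a c - a h))⁻¹ *
        ∏ h ∈ Finset.univ.erase c, (Polynomial.X + Polynomial.C (- a h)) := by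
    simp only [Lagrange.basis, Lagrange.basisDivisor, Finset.prod_mul_distrib, map_neg,
      ← sub_eq_add_neg, ← map_prod, Finset.prod_inv_distrib]
  have hcard : #(Finset.univ.erase c) = n - 1 := by simp
  rw [hb, Polynomial.coeff_C_mul, Finset.prod_X_add_C_coeff _ _ (by omega), hcard,
    show n - 1 - j = n - j - 1 by omega, div_eq_inv_mul, esymmErase, Finset.mul_sum]
  congr 1
  refine Finset.sum_congr rfl (fun T hT => ?_)
  rw [Finset.prod_neg, (Finset.mem_powersetCard.1 hT).2]

/-- Bi-orthonormality `∫_ℝ ã^i q_j^≥(ã) dã = δ_{ij}` of the monomials and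
the functions `q_j^≥`. -/
theorem statement13 (m n₁ n₂ : ℕ) (hm : n₁ < m) (h21 : n₂ ≤ n₁) (h2 : 1 ≤ n₂)
    (ω : ℝ → ℝ) (hωmeas : Measurable ω) (hωnn : ∀ x ∈ Set.Ioi (0 : ℝ), 0 ≤ ω x)
    (hωint : ∀ j < n₂, IntegrableOn (fun x => x ^ (n₁ + j - n₂) * ω x) (Set.Ioi 0))
    (hωpos : ∀ j < n₂, 0 < ∫ x in Set.Ioi (0 : ℝ), x ^ (n₁ + j - n₂) * ω x)
    (a : Fin n₂ → ℝ) (ha0 : ∀ c, a c ≠ 0) (hadist : Function.Injective a) :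
    ∀ i < n₂, ∀ j < n₂,
      (∫ t : ℝ, t ^ i * qGe m n₁ n₂ ω a j t) = if i = j then 1 else 0 := by
  intro i hi j hj
  have hmom := fun c => omega_moment m n₁ n₂ i hm h21 ω hωmeas hωnn (hωint i hi) (a c) (ha0 c)
  have hexp : (fun t : ℝ => t ^ i * qGe m n₁ n₂ ω a j t) = fun t =>
      ((Nat.factorial (m + j - n₂) : ℝ) /
      ((Nat.factorial (m - n₁) : ℝ) * (Nat.factorial (n₁ + j - n₂) : ℝ) *
        MellinNat ω (n₁ + j - n₂ + 1))) * ∑ c : Fin n₂,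
      ((-1 : ℝ) ^ (n₂ - j - 1) * esymmErase a c (n₂ - j - 1) /
          ∏ h ∈ Finset.univ.erase c, (a c - a h)) *
        (t ^ i * omegaTildeGe m n₁ n₂ ω t (a c)) := by
    ext t
    rw [qGe, mul_left_comm, Finset.mul_sum]
    congr 1
    exact Finset.sum_congr rfl (fun c _ => by ring)
  rw [hexp, integral_const_mul, integral_finsetSum _ (fun c _ => (hmom c).1.const_mul _)]
  simp only [integral_const_mul, (hmom _).2]
  simp only [← mul_assoc]
  simp only [← Finset.sum_mul]
  rw [lagrange_delta a hadist i j hi hj]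
  by_cases hij : i = j
  · subst hij
    have hp := hωpos i hi
    simp only [MellinNat, Nat.add_sub_cancel, if_true]
    have := Nat.factorial_pos (m + i - n₂)
    have := Nat.factorial_pos (m - n₁)
    have := Nat.factorial_pos (n₁ + i - n₂)
    field_simp
  · simp [hij]

end RMT
end
end

section
/- Let m > n₁ ≥ n₂ ≥ 1 be integers and let ω: (0,∞) → [0,∞) be measurable with 0 < Mω(n₁+h−n₂+1) < ∞ for all h = 0,…,n₂−1; set κ_h = (m−n₁)!(n₁+h−n₂)!·Mω(n₁+h−n₂+1)/(m+h−n₂)!. Let p_0,…,p_{n₂−1} be real polynomials with deg p_j = j, written p_j(x) = ∑_{h=0}^{j} c_{jh} x^h, and let q_0,…,q_{n₂−1}: ℝ → ℝ be measurable with ∫_ℝ |a|^h |q_j(a)| da < ∞ for all 0 ≤ h ≤ n₂−1 and satisfying ∫_ℝ p_i(a) q_j(a) da = δ_{ij} for all 0 ≤ i,j ≤ n₂−1. Define p̃_j(ã) = ∑_{h=0}^{j} (c_{jh}/κ_h) ã^h and q̃_j(ã) = ∫_ℝ ω̃_≥(ã | a) q_j(a) da. Then ∫_ℝ p̃_i(ã)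 q̃_j(ã) dã = δ_{ij} for all 0 ≤ i,j ≤ n₂−1; that is, (p̃_j, q̃_j) is again a bi-orthonormal system. -/
open MeasureTheory Finset Filter Set

noncomputable section

namespace RMT

/-- The constants `κ_h = (m−n₁)!(n₁+h−n₂)!·Mω(n₁+h−n₂+1)/(m+h−n₂)!`. -/
def kappaGe (m n₁ n₂ : ℕ) (ω : ℝ → ℝ) (h : ℕ) : ℝ :=
  (Nat.factorial (m - n₁) : ℝ) * (Nat.factorial (n₁ + h - n₂) : ℝ) *
      MellinNat ω (n₁ + h - n₂ + 1) / (Nat.factorial (m + h - n₂) : ℝ)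

lemma mc_slice (k : ℕ) (g f : ℝ → ℝ) (a : ℝ) (ha : a ≠ 0) (t : ℝ) :
    t ^ k * (|a|⁻¹ * g (t / a) * f a) =
      (|a|⁻¹ * (a ^ k * f a)) * (fun x => x ^ k * g x) (t / a) := by
  have : t = a * (t / a) := by field_simp
  calc _ = (a * (t / a)) ^ k * (|a|⁻¹ * g (t / a) * f a) := by rw [← this]
    _ = _ := by simp only [mul_pow]; ring

lemma ae_ne_zero : ∀ᵐ a : ℝ, a ≠ 0 := by
  simp [ae_iff]

lemma mc_integral_slice (k : ℕ) (g f : ℝ → ℝ) (a : ℝ) (ha : a ≠ 0) :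
    ∫ t : ℝ, t ^ k * (|a|⁻¹ * g (t / a) * f a) = (∫ x : ℝ, x ^ k * g x) * (a ^ k * f a) := by
  simp_rw [mc_slice k g f a ha]
  rw [integral_const_mul, Measure.integral_comp_div (fun x => x ^ k * g x) a]
  have : |a| ≠ 0 := abs_ne_zero.2 ha
  rw [smul_eq_mul]
  field_simp

lemma mc_integrable (k : ℕ) (g f : ℝ → ℝ) (hg : Measurable g) (hf : Measurable f)
    (hgi : Integrable (fun x => x ^ k * g x)) (hfi : Integrable (fun a => a ^ k * f a)) :
    Integrable (fun z : ℝ × ℝ => z.1 ^ k * (|z.2|⁻¹ * g (z.1 / z.2) * f z.2))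
      ((volume : Measure ℝ).prod volume) := by
  have hm : Measurable (fun z : ℝ × ℝ => z.1 ^ k * (|z.2|⁻¹ * g (z.1 / z.2) * f z.2)) := by
    have h1 : Measurable (fun z : ℝ × ℝ => g (z.1 / z.2)) :=
      hg.comp (measurable_fst.div measurable_snd)
    have h2 : Measurable (fun z : ℝ × ℝ => f z.2) := hf.comp measurable_snd
    have h3 : Measurable (fun z : ℝ × ℝ => |z.2|⁻¹) :=
      (continuous_abs.measurable.comp measurable_snd).inv
    exact (measurable_fst.pow_const k).mul ((h3.mul h1).mul h2)
  rw [integrable_prod_iff' hm.aestronglyMeasurable]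
  constructor
  · filter_upwards [ae_ne_zero] with a ha
    simp_rw [mc_slice k g f a ha]
    exact (hgi.comp_div ha).const_mul _
  · have : Integrable (fun a => (∫ x : ℝ, ‖x ^ k * g x‖) * ‖a ^ k * f a‖) := hfi.norm.const_mul _
    refine this.congr ?_
    filter_upwards [ae_ne_zero] with a ha
    simp_rw [mc_slice k g f a ha, norm_mul (|a|⁻¹ * (a ^ k * f a))]
    rw [integral_const_mul, Measure.integral_comp_div (fun x => ‖x ^ k * g x‖) a]
    have : |a| ≠ 0 := abs_ne_zero.2 ha
    rw [smul_eq_mul, norm_mul |a|⁻¹, Real.norm_eq_abs |a|⁻¹, abs_inv, abs_abs]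
    field_simp

/-- Multiplicative convolution. -/
def mc (g f : ℝ → ℝ) (t : ℝ) : ℝ := ∫ a : ℝ, |a|⁻¹ * g (t / a) * f a

lemma mc_measurable (g f : ℝ → ℝ) (hg : Measurable g) (hf : Measurable f) :
    Measurable (mc g f) := by
  have hm : Measurable (fun z : ℝ × ℝ => (|z.2|⁻¹ * g (z.1 / z.2) * f z.2)) := by
    have h1 : Measurable (fun z : ℝ × ℝ => g (z.1 / z.2)) :=
      hg.comp (measurable_fst.div measurable_snd)
    have h2 : Measurable (fun z : ℝ × ℝ => f z.2) := hf.comp measurable_snd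
    have h3 : Measurable (fun z : ℝ × ℝ => |z.2|⁻¹) :=
      (continuous_abs.measurable.comp measurable_snd).inv
    exact ((h3.mul h1).mul h2)
  exact (hm.stronglyMeasurable.integral_prod_right' (ν := volume)).measurable

lemma mc_moment (k : ℕ) (g f : ℝ → ℝ) (hg : Measurable g) (hf : Measurable f)
    (hgi : Integrable (fun x => x ^ k * g x)) (hfi : Integrable (fun a => a ^ k * f a)) :
    Integrable (fun t => t ^ k * mc g f t) ∧
    ∫ t : ℝ, t ^ k * mc g f t = (∫ x : ℝ, x ^ k * g x) * ∫ a : ℝ, a ^ k * f a := by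
  have hI := mc_integrable k g f hg hf hgi hfi
  have e : (fun t => t ^ k * mc g f t) =
      fun t => ∫ a : ℝ, t ^ k * (|a|⁻¹ * g (t / a) * f a) := by
    ext t
    rw [integral_const_mul, mc]
  constructor
  · rw [e]
    exact hI.integral_prod_left
  · rw [e, integral_integral_swap (f := fun t a => t ^ k * (|a|⁻¹ * g (t / a) * f a)) hI,
      ← integral_const_mul]
    refine integral_congr_ae ?_
    filter_upwards [ae_ne_zero] with a ha
    exact mc_integral_slice k g f a ha

lemma beta_nat_s15 (a b : ℕ) : ∫ u in Set.Ioo (0 : ℝ) 1, u ^ a * (1 - u) ^ b =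
    (a.factorial : ℝ) * b.factorial / (a + b + 1).factorial := by
  have h := Complex.Gamma_mul_Gamma_eq_betaIntegral (s := (a : ℂ) + 1) (t := (b : ℂ) + 1)
    (by simp; positivity) (by simp; positivity)
  rw [Complex.Gamma_nat_eq_factorial, Complex.Gamma_nat_eq_factorial,
    show (a : ℂ) + 1 + (b + 1) = ((a + b + 1 : ℕ) : ℂ) + 1 by push_cast; ring,
    Complex.Gamma_nat_eq_factorial, Complex.betaIntegral] at h
  simp only [add_sub_cancel_right, Complex.cpow_natCast] at h
  have e : ∫ x in (0 : ℝ)..1, (x : ℂ) ^ a * (1 - (x : ℂ)) ^ b =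
      ((∫ x in (0 : ℝ)..1, x ^ a * (1 - x) ^ b : ℝ) : ℂ) := by
    rw [← intervalIntegral.integral_ofReal]
    simp
  rw [e] at h
  rw [← integral_Ioc_eq_integral_Ioo, ← intervalIntegral.integral_of_le zero_le_one]
  have h' : (a.factorial : ℝ) * b.factorial =
      (a + b + 1).factorial * ∫ x in (0 : ℝ)..1, x ^ a * (1 - x) ^ b := by
    exact_mod_cast h
  rw [h']
  field_simp

/-- Density for the beta variable. -/
def bdens (r : ℕ) : ℝ → ℝ :=
  (Set.Ioo (0 : ℝ) 1).indicator (fun u => (r : ℝ) * (1 - u) ^ (r - 1))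

lemma bdens_measurable (r : ℕ) : Measurable (bdens r) :=
  (by fun_prop : Measurable (fun u : ℝ => (r : ℝ) * (1 - u) ^ (r - 1))).indicator
    measurableSet_Ioo

lemma bdens_eq (r k : ℕ) : (fun u => u ^ k * bdens r u) =
    (Set.Ioo (0 : ℝ) 1).indicator (fun u => (r : ℝ) * (u ^ k * (1 - u) ^ (r - 1))) := by
  ext u
  by_cases hu : u ∈ Set.Ioo (0 : ℝ) 1
  · simp only [bdens, indicator_of_mem hu]; ring
  · simp [bdens, indicator_of_notMem hu]

lemma bdens_integrable (r k : ℕ) : Integrable (fun u => u ^ k * bdens r u) := by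
  rw [bdens_eq, integrable_indicator_iff measurableSet_Ioo]
  exact ((by fun_prop : Continuous (fun u : ℝ => (r : ℝ) * (u ^ k * (1 - u) ^ (r - 1))))
    |>.integrableOn_Icc (a := 0) (b := 1)).mono_set Ioo_subset_Icc_self

lemma bdens_integral (r k : ℕ) (hr : 0 < r) : ∫ u, u ^ k * bdens r u =
    (r.factorial : ℝ) * k.factorial / (k + r).factorial := by
  rw [bdens_eq, integral_indicator measurableSet_Ioo, integral_const_mul, beta_nat_s15]
  obtain ⟨s, rfl⟩ : ∃ s, r = s + 1 := ⟨r - 1, by omega⟩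
  simp only [Nat.add_sub_cancel, Nat.factorial_succ s, ← add_assoc]
  push_cast
  ring

lemma ind_eq (ω : ℝ → ℝ) (k : ℕ) : (fun x => x ^ k * (Set.Ioi (0 : ℝ)).indicator ω x) =
    (Set.Ioi (0 : ℝ)).indicator (fun x => x ^ k * ω x) := by
  ext x
  by_cases hu : x ∈ Set.Ioi (0 : ℝ)
  · simp only [indicator_of_mem hu]
  · simp [indicator_of_notMem hu]

/-- The one-variable kernel. -/
def GG (m n₁ n₂ : ℕ) (ω : ℝ → ℝ) (x : ℝ) : ℝ :=
  x ^ (n₁ - n₂) * mc ((Set.Ioi (0 : ℝ)).indicator ω) (bdens (m - n₁)) x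

lemma omega_eq (m n₁ n₂ : ℕ) (ω : ℝ → ℝ) (t a : ℝ) :
    omegaTildeGe m n₁ n₂ ω t a = |a|⁻¹ * GG m n₁ n₂ ω (t / a) := by
  have key : mc ((Set.Ioi (0 : ℝ)).indicator ω) (bdens (m - n₁)) (t / a) =
      ∫ u in Set.Ioo (0 : ℝ) 1, |u|⁻¹ * (Set.Ioi (0 : ℝ)).indicator ω (t / a / u) *
        (((m - n₁ : ℕ) : ℝ) * (1 - u) ^ (m - n₁ - 1)) := by
    rw [mc, ← integral_indicator measurableSet_Ioo]
    congr 1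
    ext u
    by_cases hu : u ∈ Set.Ioo (0 : ℝ) 1
    · simp only [bdens, indicator_of_mem hu]
    · simp only [bdens, indicator_of_notMem hu, mul_zero]
  rw [omegaTildeGe, GG, key]
  by_cases h : 0 < t * a
  · have hd : 0 < t / a := by
      rcases mul_pos_iff.1 h with ⟨h1, h2⟩ | ⟨h1, h2⟩
      · exact div_pos h1 h2
      · exact div_pos_of_neg_of_neg h1 h2
    rw [if_pos h, one_mul, mul_left_comm]
    congr 1
    rw [← integral_const_mul]
    refine setIntegral_congr_fun (measurableSet_Ioo (a := (0:ℝ)) (b := 1)) ?_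
    intro u hu
    have hu0 : 0 < u := hu.1
    have : t / a / u ∈ Set.Ioi (0 : ℝ) := div_pos hd hu0
    simp only [indicator_of_mem this]
    rw [abs_of_pos hu0, div_div, div_eq_mul_inv, mul_inv]
    ring
  · rw [if_neg h, zero_mul, zero_mul]
    have hd : t / a ≤ 0 := by
      by_contra hc
      push Not at hc
      rcases div_pos_iff.1 hc with ⟨h1, h2⟩ | ⟨h1, h2⟩
      · exact h (mul_pos h1 h2)
      · exact h (mul_pos_of_neg_of_neg h1 h2)
    rw [setIntegral_eq_zero_of_forall_eq_zero]
    · simp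
    · intro u hu
      have : t / a / u ∉ Set.Ioi (0 : ℝ) := by
        simpa using div_nonpos_of_nonpos_of_nonneg hd hu.1.le
      simp only [indicator_of_notMem this]
      simp

lemma GG_measurable (m n₁ n₂ : ℕ) (ω : ℝ → ℝ) (hω : Measurable ω) :
    Measurable (GG m n₁ n₂ ω) :=
  (measurable_id.pow_const _).mul
    (mc_measurable _ _ (hω.indicator measurableSet_Ioi) (bdens_measurable _))

lemma GG_moment (m n₁ n₂ : ℕ) (hm : n₁ < m) (h21 : n₂ ≤ n₁)
    (ω : ℝ → ℝ) (hωmeas : Measurable ω) (h : ℕ)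
    (hωint : IntegrableOn (fun x => x ^ (n₁ + h - n₂) * ω x) (Set.Ioi 0)) :
    Integrable (fun x => x ^ h * GG m n₁ n₂ ω x) ∧
      ∫ x, x ^ h * GG m n₁ n₂ ω x = kappaGe m n₁ n₂ ω h := by
  have e : (fun x => x ^ h * GG m n₁ n₂ ω x) = fun x => x ^ (n₁ + h - n₂) *
      mc ((Set.Ioi (0 : ℝ)).indicator ω) (bdens (m - n₁)) x := by
    ext x
    rw [GG, ← mul_assoc, ← pow_add, show h + (n₁ - n₂) = n₁ + h - n₂ by omega]
  have H := mc_moment (n₁ + h - n₂) ((Set.Ioi (0 : ℝ)).indicator ω) (bdens (m - n₁))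
    (hωmeas.indicator measurableSet_Ioi) (bdens_measurable _)
    (by rw [ind_eq]; exact hωint.integrable_indicator measurableSet_Ioi)
    (bdens_integrable _ _)
  rw [e]
  refine ⟨H.1, H.2.trans ?_⟩
  rw [bdens_integral _ _ (by omega), ind_eq, integral_indicator measurableSet_Ioi, kappaGe,
    MellinNat, show n₁ + h - n₂ + (m - n₁) = m + h - n₂ by omega]
  simp only [Nat.add_sub_cancel]
  ring

/-- Transformation of a bi-orthonormal system under the multiplicative
action of a Pólya-type weight: `(p̃_j, q̃_j)` is again bi-orthonormal. -/
theorem statement15 (m n₁ n₂ : ℕ) (hm : n₁ < m) (h21 : n₂ ≤ n₁) (h2 : 1 ≤ n₂)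
    (ω : ℝ → ℝ) (hωmeas : Measurable ω) (hωnn : ∀ x ∈ Set.Ioi (0 : ℝ), 0 ≤ ω x)
    (hωint : ∀ h < n₂, IntegrableOn (fun x => x ^ (n₁ + h - n₂) * ω x) (Set.Ioi 0))
    (hωpos : ∀ h < n₂, 0 < ∫ x in Set.Ioi (0 : ℝ), x ^ (n₁ + h - n₂) * ω x)
    (c : Fin n₂ → ℕ → ℝ) (hdeg : ∀ j : Fin n₂, c j (j : ℕ) ≠ 0)
    (q : Fin n₂ → ℝ → ℝ) (hqmeas : ∀ j, Measurable (q j))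
    (hqint : ∀ h < n₂, ∀ j, Integrable (fun a : ℝ => |a| ^ h * |q j a|))
    (hbi : ∀ i j : Fin n₂,
      (∫ a : ℝ, (∑ h ∈ Finset.range ((i : ℕ) + 1), c i h * a ^ h) * q j a) =
        if i = j then 1 else 0) :
    ∀ i j : Fin n₂,
      (∫ t : ℝ,
          (∑ h ∈ Finset.range ((i : ℕ) + 1), c i h / kappaGe m n₁ n₂ ω h * t ^ h) *
            ∫ a : ℝ, omegaTildeGe m n₁ n₂ ω t a * q j a) =
        if i = j then 1 else 0 := by
  have hq : ∀ h < n₂, ∀ j, Integrable (fun a : ℝ => a ^ h * q j a) := by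
    intro h hh j
    refine (hqint h hh j).mono' ?_ ?_
    · exact ((measurable_id.pow_const h).mul (hqmeas j)).aestronglyMeasurable
    · filter_upwards with a
      simp [abs_mul, abs_pow]
  have hk : ∀ h < n₂, kappaGe m n₁ n₂ ω h ≠ 0 := by
    intro h hh
    have := hωpos h hh
    have : 0 < kappaGe m n₁ n₂ ω h := by
      rw [kappaGe, MellinNat]
      simp only [Nat.add_sub_cancel]
      positivity
    exact this.ne'
  intro i j
  rw [← hbi i j]
  have hlt : ∀ h ∈ Finset.range ((i : ℕ) + 1), h < n₂ := by
    intro h hh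
    have := Finset.mem_range.1 hh
    omega
  have hmc : ∀ t, (∫ a : ℝ, omegaTildeGe m n₁ n₂ ω t a * q j a) =
      mc (GG m n₁ n₂ ω) (q j) t := by
    intro t
    simp_rw [omega_eq]
    rfl
  have HG : ∀ h < n₂, _ := fun h hh => GG_moment m n₁ n₂ hm h21 ω hωmeas h (hωint h hh)
  have HM : ∀ h < n₂, _ := fun h hh => mc_moment h (GG m n₁ n₂ ω) (q j)
    (GG_measurable m n₁ n₂ ω hωmeas) (hqmeas j) (HG h hh).1 (hq h hh j)
  simp_rw [hmc, Finset.sum_mul, mul_assoc]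
  rw [integral_finsetSum _ (fun h hh => (HM h (hlt h hh)).1.const_mul _),
    integral_finsetSum _ (fun h hh => (hq h (hlt h hh) j).const_mul _)]
  refine Finset.sum_congr rfl fun h hh => ?_
  rw [integral_const_mul, integral_const_mul, (HM h (hlt h hh)).2, (HG h (hlt h hh)).2]
  have := hk h (hlt h hh)
  field_simp

end RMT
end
end

section
/- For n ≥ 1 let ζ_n: ℝ → ℝ be defined by ζ_n(z) = cos(z) / ∏_{k=1}^{n} (1 − 4z²/(π(2k−1))²), with the removable singularities at z = ±π(2k−1)/2 (1 ≤ k ≤ n) filled by continuity. Then ζ_n is Lebesgue integrable on ℝ and there exists a constant c ≠ 0 such that for all u ∈ ℝ: (1/(2π)) ∫_ℝ ζ_n(z) e^{−i z u} dz = c · 1{|u| ≤ 1} · cos^{2n−1}(π u / 2). -/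
open MeasureTheory Finset Filter Set
open scoped Classical

noncomputable section

namespace RMT

/-- The function `cos(z) / ∏_{k=1}^n (1 - 4z²/(π(2k-1))²)`, as a raw formula. -/
def zetaRaw (n : ℕ) (z : ℝ) : ℝ :=
  Real.cos z / ∏ k ∈ Finset.range n, (1 - 4 * z ^ 2 / (Real.pi * (2 * (k : ℝ) + 1)) ^ 2)

/-- The regularizing function `ζ_n`, with the removable singularities at
`z = ±π(2k-1)/2` filled by continuity. -/
def zetaReg (n : ℕ) (z : ℝ) : ℝ :=
  if (∏ k ∈ Finset.range n, (1 - 4 * z ^ 2 / (Real.pi * (2 * (k : ℝ) + 1)) ^ 2)) ≠ 0 then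
    zetaRaw n z
  else limUnder (nhdsWithin z {z}ᶜ) (zetaRaw n)

end RMT

namespace RMT

/-- Cosine transform of `cos^(2j+1)(πu/2)` on `[-1,1]`. -/
def G (j : ℕ) (z : ℝ) : ℝ :=
  ∫ u in (-1 : ℝ)..1, Real.cos (Real.pi * u / 2) ^ (2 * j + 1) * Real.cos (z * u)

lemma G_continuous (j : ℕ) : Continuous (G j) := by
  unfold G
  apply intervalIntegral.continuous_parametric_intervalIntegral_of_continuous'
  fun_prop

lemma G_base (z : ℝ) :
    ((Real.pi / 2) ^ 2 - z ^ 2) * G 0 z = Real.pi * Real.cos z := by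
  have h : ∫ u in (-1 : ℝ)..1,
      ((Real.pi / 2) ^ 2 - z ^ 2) * (Real.cos (Real.pi * u / 2) ^ (2 * 0 + 1) * Real.cos (z * u))
      = (Real.pi / 2 * Real.sin (Real.pi * 1 / 2) * Real.cos (z * 1)
          - z * Real.cos (Real.pi * 1 / 2) * Real.sin (z * 1))
        - (Real.pi / 2 * Real.sin (Real.pi * (-1) / 2) * Real.cos (z * (-1))
          - z * Real.cos (Real.pi * (-1) / 2) * Real.sin (z * (-1))) := by
    apply intervalIntegral.integral_eq_sub_of_hasDerivAt
      (f := fun u => Real.pi / 2 * Real.sin (Real.pi * u / 2) * Real.cos (z * u)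
          - z * Real.cos (Real.pi * u / 2) * Real.sin (z * u))
    · intro u _
      have h1 : HasDerivAt (fun u : ℝ => Real.pi * u / 2) (Real.pi / 2) u := by
        simpa using ((hasDerivAt_id u).const_mul Real.pi).div_const 2
      have h2 : HasDerivAt (fun u : ℝ => z * u) z u := by
        simpa using (hasDerivAt_id u).const_mul z
      refine (((h1.sin.const_mul (Real.pi / 2)).mul h2.cos).sub
        ((h1.cos.const_mul z).mul h2.sin)).congr_deriv ?_
      ring
    · apply Continuous.intervalIntegrable
      fun_prop
  rw [intervalIntegral.integral_const_mul] at h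
  unfold G
  rw [h]
  have e : Real.pi * (-1) / 2 = -(Real.pi / 2) := by ring
  rw [e]
  simp
  ring

lemma G_step (j : ℕ) (z : ℝ) :
    ((Real.pi / 2) ^ 2 * (2 * j + 3) ^ 2 - z ^ 2) * G (j + 1) z
      = (Real.pi / 2) ^ 2 * (2 * j + 3) * (2 * j + 2) * G j z := by
  have h : ∫ u in (-1 : ℝ)..1,
      (((Real.pi / 2) ^ 2 * (2 * j + 3) ^ 2 - z ^ 2) *
        (Real.cos (Real.pi * u / 2) ^ (2 * (j + 1) + 1) * Real.cos (z * u))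
      - (Real.pi / 2) ^ 2 * (2 * j + 3) * (2 * j + 2) *
        (Real.cos (Real.pi * u / 2) ^ (2 * j + 1) * Real.cos (z * u)))
      = ((2 * j + 3) * (Real.pi / 2) * Real.cos (Real.pi * 1 / 2) ^ (2 * j + 2) *
            Real.sin (Real.pi * 1 / 2) * Real.cos (z * 1)
          - z * Real.cos (Real.pi * 1 / 2) ^ (2 * j + 3) * Real.sin (z * 1))
        - ((2 * j + 3) * (Real.pi / 2) * Real.cos (Real.pi * (-1) / 2) ^ (2 * j + 2) *
            Real.sin (Real.pi * (-1) / 2) * Real.cos (z * (-1))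
          - z * Real.cos (Real.pi * (-1) / 2) ^ (2 * j + 3) * Real.sin (z * (-1))) := by
    apply intervalIntegral.integral_eq_sub_of_hasDerivAt
      (f := fun u => (2 * j + 3) * (Real.pi / 2) * Real.cos (Real.pi * u / 2) ^ (2 * j + 2) *
            Real.sin (Real.pi * u / 2) * Real.cos (z * u)
          - z * Real.cos (Real.pi * u / 2) ^ (2 * j + 3) * Real.sin (z * u))
    · intro u _
      have h1 : HasDerivAt (fun u : ℝ => Real.pi * u / 2) (Real.pi / 2) u := by
        simpa using ((hasDerivAt_id u).const_mul Real.pi).div_const 2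
      have h2 : HasDerivAt (fun u : ℝ => z * u) z u := by
        simpa using (hasDerivAt_id u).const_mul z
      refine (((((h1.cos.pow (2 * j + 2)).const_mul ((2 * j + 3) * (Real.pi / 2))).mul
        h1.sin).mul h2.cos).sub
        (((h1.cos.pow (2 * j + 3)).const_mul z).mul h2.sin)).congr_deriv ?_
      have hs : Real.sin (Real.pi * u / 2) ^ 2 = 1 - Real.cos (Real.pi * u / 2) ^ 2 :=
        Real.sin_sq _
      simp only [show 2 * j + 2 - 1 = 2 * j + 1 by omega,
        show 2 * j + 3 - 1 = 2 * j + 2 by omega, Pi.mul_apply, Pi.pow_apply]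
      push_cast
      generalize Real.sin (Real.pi * u / 2) = s at *
      generalize Real.cos (Real.pi * u / 2) = c at *
      linear_combination (-(2 * j + 3) * (Real.pi / 2) ^ 2 * (2 * j + 2) * c ^ (2 * j + 1) *
        Real.cos (z * u)) * hs
    · apply Continuous.intervalIntegrable
      fun_prop
  rw [intervalIntegral.integral_sub, intervalIntegral.integral_const_mul,
    intervalIntegral.integral_const_mul] at h
  · have e : Real.pi * (-1) / 2 = -(Real.pi / 2) := by ring
    rw [e] at h
    simp at h
    unfold G
    linarith
  · apply Continuous.intervalIntegrable
    fun_prop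
  · apply Continuous.intervalIntegrable
    fun_prop

lemma G_prod (j : ℕ) : ∃ C : ℝ, C ≠ 0 ∧ ∀ z, G j z *
    ∏ k ∈ Finset.range (j + 1), (1 - 4 * z ^ 2 / (Real.pi * (2 * (k : ℝ) + 1)) ^ 2)
      = C * Real.cos z := by
  have hpi := Real.pi_ne_zero
  induction j with
  | zero =>
    refine ⟨4 / Real.pi, by positivity, fun z => ?_⟩
    have h := G_base z
    simp only [zero_add, Finset.prod_range_one, Nat.cast_zero, mul_zero, mul_one]
    field_simp
    linear_combination 4 * h
  | succ j ih =>
    obtain ⟨C, hC, h⟩ := ih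
    have h3 : (2 * (j : ℝ) + 3) ≠ 0 := by positivity
    have h2 : (2 * (j : ℝ) + 2) ≠ 0 := by positivity
    refine ⟨(2 * j + 2) / (2 * j + 3) * C, by positivity, fun z => ?_⟩
    rw [Finset.prod_range_succ]
    have hs := G_step j z
    have key : G (j + 1) z * (1 - 4 * z ^ 2 / (Real.pi * (2 * ((j + 1 : ℕ) : ℝ) + 1)) ^ 2)
        = (2 * j + 2) / (2 * j + 3) * G j z := by
      push_cast
      have e : 2 * ((j : ℝ) + 1) + 1 = 2 * j + 3 := by ring
      rw [e]
      field_simp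
      linear_combination 4 * hs
    rw [mul_comm (Finset.prod _ _), ← mul_assoc, key, mul_assoc, h z, mul_assoc]

lemma G_bdd (j : ℕ) (z : ℝ) : |G j z| ≤ 2 := by
  have := intervalIntegral.norm_integral_le_of_norm_le_const (a := (-1 : ℝ)) (b := 1) (C := 1)
    (f := fun u => Real.cos (Real.pi * u / 2) ^ (2 * j + 1) * Real.cos (z * u)) (by
      intro u _
      rw [norm_mul, norm_pow]
      exact mul_le_one₀ (pow_le_one₀ (norm_nonneg _) (Real.abs_cos_le_one _)) (norm_nonneg _)
        (Real.abs_cos_le_one _))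
  rw [Real.norm_eq_abs] at this
  unfold G
  refine this.trans (by norm_num)

lemma G_decay (j : ℕ) : ∃ K : ℝ, ∀ z, |z ^ 2 * G j z| ≤ K := by
  cases j with
  | zero =>
    refine ⟨(Real.pi / 2) ^ 2 * 2 + Real.pi, fun z => ?_⟩
    have e : z ^ 2 * G 0 z = (Real.pi / 2) ^ 2 * G 0 z - Real.pi * Real.cos z := by
      linarith [G_base z]
    rw [e]
    refine (abs_sub _ _).trans ?_
    rw [abs_mul, abs_mul, abs_of_pos Real.pi_pos, abs_of_nonneg (sq_nonneg (Real.pi / 2))]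
    have := mul_le_mul_of_nonneg_left (Real.abs_cos_le_one z) Real.pi_pos.le
    have := mul_le_mul_of_nonneg_left (G_bdd 0 z) (sq_nonneg (Real.pi / 2))
    linarith
  | succ j =>
    refine ⟨(Real.pi / 2) ^ 2 * (2 * j + 3) ^ 2 * 2
      + (Real.pi / 2) ^ 2 * (2 * j + 3) * (2 * j + 2) * 2, fun z => ?_⟩
    have e : z ^ 2 * G (j + 1) z = (Real.pi / 2) ^ 2 * (2 * j + 3) ^ 2 * G (j + 1) z
        - (Real.pi / 2) ^ 2 * (2 * j + 3) * (2 * j + 2) * G j z := by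
      linarith [G_step j z]
    rw [e]
    refine (abs_sub _ _).trans ?_
    have p1 : 0 ≤ (Real.pi / 2) ^ 2 * (2 * (j : ℝ) + 3) ^ 2 := by positivity
    have p2 : 0 ≤ (Real.pi / 2) ^ 2 * (2 * (j : ℝ) + 3) * (2 * j + 2) := by positivity
    rw [abs_mul _ (G (j + 1) z), abs_mul _ (G j z), abs_of_nonneg p1, abs_of_nonneg p2]
    exact add_le_add (mul_le_mul_of_nonneg_left (G_bdd _ z) p1)
      (mul_le_mul_of_nonneg_left (G_bdd _ z) p2)

lemma G_integrable (j : ℕ) : Integrable (G j) := by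
  obtain ⟨K, hK⟩ := G_decay j
  refine (integrable_inv_one_add_sq.const_mul (2 + K)).mono'
    (G_continuous j).aestronglyMeasurable (Eventually.of_forall fun z => ?_)
  rw [Real.norm_eq_abs, ← div_eq_mul_inv, le_div_iff₀ (by positivity)]
  have h1 := hK z
  rw [abs_mul, abs_of_nonneg (sq_nonneg z)] at h1
  linarith [G_bdd j z]

lemma prod_ne_eventually (n : ℕ) (z : ℝ) : ∀ᶠ y in nhdsWithin z {z}ᶜ,
    (∏ k ∈ Finset.range n, (1 - 4 * y ^ 2 / (Real.pi * (2 * (k : ℝ) + 1)) ^ 2)) ≠ 0 := by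
  simp only [Finset.prod_ne_zero_iff]
  rw [Filter.eventually_all_finset]
  intro k _
  have hfin : ({Real.pi * (2 * (k : ℝ) + 1) / 2, -(Real.pi * (2 * (k : ℝ) + 1) / 2)} \ {z} :
      Set ℝ).Finite := (Set.toFinite _).subset Set.sdiff_subset
  have hmem := hfin.isClosed.isOpen_compl.mem_nhds (x := z) (by simp)
  filter_upwards [mem_nhdsWithin_of_mem_nhds hmem, self_mem_nhdsWithin] with y hy hyz h0
  apply hy
  refine ⟨?_, hyz⟩
  have hp : Real.pi * (2 * (k : ℝ) + 1) ≠ 0 := by positivity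
  have : y ^ 2 = (Real.pi * (2 * (k : ℝ) + 1) / 2) ^ 2 := by
    field_simp at h0
    linear_combination (-1 / 4) * h0
  exact sq_eq_sq_iff_eq_or_eq_neg.mp this

lemma zetaReg_eq (j : ℕ) : ∃ C : ℝ, C ≠ 0 ∧ ∀ z, zetaReg (j + 1) z = C * G j z := by
  obtain ⟨C, hC, h⟩ := G_prod j
  refine ⟨C⁻¹, inv_ne_zero hC, fun z => ?_⟩
  have raw : ∀ y, (∏ k ∈ Finset.range (j + 1),
      (1 - 4 * y ^ 2 / (Real.pi * (2 * (k : ℝ) + 1)) ^ 2)) ≠ 0 →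
      zetaRaw (j + 1) y = C⁻¹ * G j y := by
    intro y hy
    unfold zetaRaw
    rw [div_eq_iff hy, mul_assoc, h y, inv_mul_cancel_left₀ hC]
  unfold zetaReg
  split_ifs with hz
  · exact raw z hz
  · apply Filter.Tendsto.limUnder_eq
    have ht : Tendsto (fun y => C⁻¹ * G j y) (nhdsWithin z {z}ᶜ) (nhds (C⁻¹ * G j z)) :=
      ((continuous_const.mul (G_continuous j)).tendsto z).mono_left nhdsWithin_le_nhds
    refine ht.congr' ?_
    filter_upwards [prod_ne_eventually (j + 1) z] with y hy
    exact (raw y hy).symm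

/-- The truncated cosine power. -/
def F (j : ℕ) (u : ℝ) : ℂ :=
  if |u| ≤ 1 then ((Real.cos (Real.pi * u / 2) : ℝ) : ℂ) ^ (2 * j + 1) else 0

lemma F_continuous (j : ℕ) : Continuous (F j) := by
  unfold F
  refine Continuous.if_le (by fun_prop) continuous_const continuous_abs continuous_const ?_
  intro x hx
  rcases (abs_eq zero_le_one).mp hx with rfl | rfl
  · simp
  · rw [show Real.pi * (-1) / 2 = -(Real.pi / 2) by ring]
    simp

lemma F_eq_indicator (j : ℕ) : F j = Set.indicator (Set.Icc (-1) 1)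
    (fun u => ((Real.cos (Real.pi * u / 2) : ℝ) : ℂ) ^ (2 * j + 1)) := by
  ext u
  simp only [F, Set.indicator, Set.mem_Icc, abs_le]

lemma F_integrable (j : ℕ) : Integrable (F j) := by
  rw [F_eq_indicator, integrable_indicator_iff measurableSet_Icc]
  apply Continuous.integrableOn_Icc
  fun_prop

open FourierTransform in
lemma F_fourier (j : ℕ) (w : ℝ) : 𝓕 (F j) w = (G j (2 * Real.pi * w) : ℂ) := by
  rw [Real.fourier_real_eq_integral_exp_smul]
  set h : ℝ → ℂ := fun v => Complex.exp (↑(-2 * Real.pi * v * w) * Complex.I) *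
    ((Real.cos (Real.pi * v / 2) : ℝ) : ℂ) ^ (2 * j + 1) with hh
  have hc : Continuous h := by rw [hh]; fun_prop
  have e1 : ∫ v : ℝ, Complex.exp (↑(-2 * Real.pi * v * w) * Complex.I) • F j v
      = ∫ v in (-1 : ℝ)..1, h v := by
    rw [intervalIntegral.integral_of_le (by norm_num), ← integral_Icc_eq_integral_Ioc,
      ← integral_indicator measurableSet_Icc, F_eq_indicator]
    congr 1
    ext v
    by_cases hv : v ∈ Set.Icc (-1 : ℝ) 1 <;> simp [hv, hh]
  have e2 : ∫ v in (-1 : ℝ)..1, h (-v) = ∫ v in (-1 : ℝ)..1, h v := by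
    rw [intervalIntegral.integral_comp_neg]; simp
  have e3 : (∫ v in (-1 : ℝ)..1, h v) + ∫ v in (-1 : ℝ)..1, h (-v)
      = 2 * (G j (2 * Real.pi * w) : ℂ) := by
    rw [← intervalIntegral.integral_add (g := fun v => h (-v)) (hc.intervalIntegrable _ _)
      ((hc.comp continuous_neg).intervalIntegrable _ _)]
    unfold G
    rw [← intervalIntegral.integral_ofReal, ← intervalIntegral.integral_const_mul]
    congr 1
    ext v
    have c1 : Real.cos (Real.pi * (-v) / 2) = Real.cos (Real.pi * v / 2) := by
      rw [← Real.cos_neg]; congr 1; ring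
    simp only [hh, c1]
    push_cast
    rw [Complex.cos.eq_1 (2 * _ * _ * _)]
    have a1 : -2 * (Real.pi : ℂ) * v * w * Complex.I = -(2 * Real.pi * w * v) * Complex.I := by
      ring
    have a2 : -2 * (Real.pi : ℂ) * (-v) * w * Complex.I = (2 * Real.pi * w * v) * Complex.I := by
      ring
    rw [a1, a2]
    ring
  rw [e1]
  rw [e2] at e3
  linear_combination e3 / 2

open FourierTransform in
lemma G_inversion (j : ℕ) (u : ℝ) :
    (1 / (2 * (Real.pi : ℂ))) * ∫ z : ℝ, (G j z : ℂ) * Complex.exp (-(Complex.I * z * u))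
      = F j u := by
  have hpi := Real.pi_pos
  have hF : 𝓕 (F j) = fun w => (G j (2 * Real.pi * w) : ℂ) := funext (F_fourier j)
  have hint : Integrable (𝓕 (F j)) := by
    rw [hF]
    exact ((G_integrable j).comp_mul_left' (by positivity)).ofReal
  have hinv := congrFun ((F_continuous j).fourierInv_fourier_eq (F_integrable j) hint) (-u)
  have hneg : F j (-u) = F j u := by
    unfold F
    rw [abs_neg, show Real.pi * (-u) / 2 = -(Real.pi * u / 2) by ring, Real.cos_neg]
  rw [hneg, hF, Real.fourierInv_eq'] at hinv
  rw [← hinv]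
  have hs := Measure.integral_comp_mul_left
    (fun z : ℝ => (G j z : ℂ) * Complex.exp (-(Complex.I * z * u))) (2 * Real.pi)
  rw [abs_of_pos (by positivity)] at hs
  have e : (1 / (2 * (Real.pi : ℂ))) = (((2 * Real.pi)⁻¹ : ℝ) : ℂ) := by push_cast; ring
  rw [e, ← Complex.real_smul, ← hs]
  congr 1
  ext v
  rw [smul_eq_mul, mul_comm]
  congr 2
  simp
  ring

/-- `ζ_n` is integrable and its inverse Fourier transform is a constant
multiple of `1{|u| ≤ 1} cos^{2n-1}(π u/2)`. -/
theorem statement18 (n : ℕ) (hn : 1 ≤ n) :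
    Integrable (zetaReg n) ∧
    ∃ c : ℝ, c ≠ 0 ∧ ∀ u : ℝ,
      (1 / (2 * (Real.pi : ℂ))) *
          ∫ z : ℝ, (zetaReg n z : ℂ) * Complex.exp (-(Complex.I * z * u)) =
        (c : ℂ) * (if |u| ≤ 1 then 1 else 0) *
          ((Real.cos (Real.pi * u / 2) : ℝ) : ℂ) ^ (2 * n - 1) := by
  obtain ⟨j, rfl⟩ : ∃ j, n = j + 1 := ⟨n - 1, by omega⟩
  obtain ⟨C, hC, h⟩ := zetaReg_eq j
  have hz : zetaReg (j + 1) = fun z => C * G j z := funext h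
  refine ⟨by rw [hz]; exact (G_integrable j).const_mul C, C, hC, fun u => ?_⟩
  have hu := G_inversion j u
  simp only [h, Complex.ofReal_mul, mul_assoc]
  rw [integral_const_mul]
  simp only [mul_assoc] at hu
  rw [mul_left_comm, hu, show 2 * (j + 1) - 1 = 2 * j + 1 by omega]
  unfold F
  split_ifs <;> simp

end RMT
end
end

section
/- Let m > n₁ ≥ n₂ ≥ 1 be integers, let b ≥ 0 be an integer, let ω: (0,∞) → [0,∞) be measurable with Mω(n₁+b−n₂+1) < ∞, and let a be a nonzero real number. Then ∫_ℝ ã^b · ω̃_≥(ã | a) dã = ( (m−n₁)! (n₁+b−n₂)! / (m+b−n₂)! ) · Mω(n₁+b−n₂+1) · a^b. -/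
open MeasureTheory Finset Filter Set

noncomputable section

namespace RMT

lemma beta_nat_aux (N j : ℕ) :
    ∫ u in Set.Ioo (0 : ℝ) 1, u ^ N * (1 - u) ^ j =
      (Nat.factorial N : ℝ) * (Nat.factorial j : ℝ) / (Nat.factorial (N + j + 1) : ℝ) := by
  have h := Complex.betaIntegral_eq_Gamma_mul_div ((N : ℂ) + 1) ((j : ℂ) + 1)
    (by simp; positivity) (by simp; positivity)
  have e : (N : ℂ) + 1 + ((j : ℂ) + 1) = ((N + j + 1 : ℕ) : ℂ) + 1 := by push_cast; ring
  rw [e, Complex.Gamma_nat_eq_factorial, Complex.Gamma_nat_eq_factorial,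
    Complex.Gamma_nat_eq_factorial, Complex.betaIntegral] at h
  have h2 : ∫ x in (0:ℝ)..1, (x : ℂ) ^ ((N : ℂ) + 1 - 1) * (1 - (x : ℂ)) ^ ((j : ℂ) + 1 - 1)
      = ((∫ x in (0:ℝ)..1, x ^ N * (1 - x) ^ j : ℝ) : ℂ) := by
    rw [← intervalIntegral.integral_ofReal]
    congr 1
    ext x
    simp [Complex.cpow_natCast]
  rw [h2] at h
  rw [← integral_Ioc_eq_integral_Ioo, ← intervalIntegral.integral_of_le zero_le_one]
  apply Complex.ofReal_injective
  rw [h]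
  push_cast
  rfl

/-- Moments of the weight `ω̃_≥(·|a)`:
`∫_ℝ ã^b ω̃_≥(ã|a) dã = ((m−n₁)!(n₁+b−n₂)!/(m+b−n₂)!) Mω(n₁+b−n₂+1) a^b`. -/
theorem statement19 (m n₁ n₂ b : ℕ) (hm : n₁ < m) (h21 : n₂ ≤ n₁) (h2 : 1 ≤ n₂)
    (ω : ℝ → ℝ) (hωmeas : Measurable ω) (hωnn : ∀ x ∈ Set.Ioi (0 : ℝ), 0 ≤ ω x)
    (hωint : IntegrableOn (fun x => x ^ (n₁ + b - n₂) * ω x) (Set.Ioi 0))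
    (a : ℝ) (ha : a ≠ 0) :
    (∫ t : ℝ, t ^ b * omegaTildeGe m n₁ n₂ ω t a) =
      ((Nat.factorial (m - n₁) : ℝ) * (Nat.factorial (n₁ + b - n₂) : ℝ) /
          (Nat.factorial (m + b - n₂) : ℝ)) *
        MellinNat ω (n₁ + b - n₂ + 1) * a ^ b := by
  obtain ⟨d, rfl⟩ := Nat.exists_eq_add_of_le h21
  obtain ⟨j, rfl⟩ := Nat.exists_eq_add_of_lt hm
  have e1 : n₂ + d + b - n₂ = d + b := by omega
  have e2 : n₂ + d + j + 1 - (n₂ + d) = j + 1 := by omega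
  have e3 : n₂ + d + j + 1 + b - n₂ = d + b + j + 1 := by omega
  have e4 : n₂ + d - n₂ = d := by omega
  simp only [omegaTildeGe, MellinNat, e1, e2, e3, e4, Nat.add_sub_cancel] at hωint ⊢
  set N := d + b with hN
  set M := ∫ x in Set.Ioi (0 : ℝ), x ^ N * ω x with hM
  let F : ℝ → ℝ → ℝ := fun u s =>
    ((j + 1 : ℕ) : ℝ) * (1 - u) ^ j * (s ^ N * ω (s / u) / u)
  -- inner computations
  have hinner : ∀ u ∈ Set.Ioo (0 : ℝ) 1, ∫ s in Set.Ioi (0 : ℝ), F u s =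
      ((j + 1 : ℕ) : ℝ) * M * (u ^ N * (1 - u) ^ j) := by
    intro u hu
    have hu0 : u ≠ 0 := hu.1.ne'
    have := integral_comp_mul_left_Ioi (fun x => x ^ N * ω x) 0 (inv_pos.mpr hu.1)
    rw [mul_zero, ← hM, inv_inv, smul_eq_mul] at this
    have h3 : ∀ s, F u s = ((j + 1 : ℕ) : ℝ) * (1 - u) ^ j * (u ^ N / u) *
        ((u⁻¹ * s) ^ N * ω (u⁻¹ * s)) := by
      intro s
      simp only [F]
      rw [show s / u = u⁻¹ * s by field_simp, mul_pow, inv_pow]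
      field_simp
    simp_rw [h3]
    rw [integral_const_mul, this]
    field_simp
  have hint1 : ∀ u ∈ Set.Ioo (0 : ℝ) 1, IntegrableOn (F u) (Set.Ioi (0 : ℝ)) := by
    intro u hu
    have hu0 : u ≠ 0 := hu.1.ne'
    have := (integrableOn_Ioi_comp_mul_left_iff (fun x => x ^ N * ω x) 0 (inv_pos.mpr hu.1)).2
      (by simpa using hωint)
    have h3 : F u = fun s => ((j + 1 : ℕ) : ℝ) * (1 - u) ^ j * (u ^ N / u) *
        ((u⁻¹ * s) ^ N * ω (u⁻¹ * s)) := by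
      ext s
      simp only [F]
      rw [show s / u = u⁻¹ * s by field_simp, mul_pow, inv_pow]
      field_simp
    rw [h3]
    exact Integrable.const_mul this _
  have hnn : ∀ u ∈ Set.Ioo (0 : ℝ) 1, ∀ s ∈ Set.Ioi (0 : ℝ), 0 ≤ F u s := by
    intro u hu s hs
    have h1 : 0 ≤ ω (s / u) := hωnn _ (div_pos hs hu.1)
    have h2 : 0 ≤ 1 - u := by linarith [hu.2]
    have h3 : 0 < u := hu.1
    have h4 : 0 < s := hs
    positivity
  have hF : Integrable (Function.uncurry F)
      ((volume.restrict (Set.Ioo (0 : ℝ) 1)).prod (volume.restrict (Set.Ioi (0 : ℝ)))) := by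
    have hmeas : Measurable (Function.uncurry F) := by
      simp only [F, Function.uncurry_def]
      fun_prop
    rw [integrable_prod_iff hmeas.aestronglyMeasurable]
    constructor
    · filter_upwards [ae_restrict_mem measurableSet_Ioo] with u hu
      exact hint1 u hu
    · have hc : IntegrableOn (fun u : ℝ => ((j + 1 : ℕ) : ℝ) * M * (u ^ N * (1 - u) ^ j))
          (Set.Ioo 0 1) :=
        (Continuous.integrableOn_Icc (by fun_prop)).mono_set Set.Ioo_subset_Icc_self
      refine Integrable.congr hc ?_
      filter_upwards [ae_restrict_mem measurableSet_Ioo] with u hu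
      rw [← hinner u hu]
      refine setIntegral_congr_fun measurableSet_Ioi fun s hs => ?_
      exact (Real.norm_of_nonneg (hnn u hu s hs)).symm
  have hswap := integral_integral_swap hF
  rw [setIntegral_congr_fun measurableSet_Ioo hinner, integral_const_mul, beta_nat_aux] at hswap
  -- change of variables t = a s
  have hcv := Measure.integral_comp_mul_left (fun t : ℝ => t ^ b *
    ((if 0 < t * a then 1 else 0) * (t / a) ^ d *
      ∫ u in Set.Ioo (0 : ℝ) 1,
        (((j + 1 : ℕ) : ℝ) * (1 - u) ^ j * ω (t / (a * u))) / (|a| * u))) a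
  have hpt : (fun s : ℝ => (a * s) ^ b *
    ((if 0 < (a * s) * a then 1 else 0) * (a * s / a) ^ d *
      ∫ u in Set.Ioo (0 : ℝ) 1,
        (((j + 1 : ℕ) : ℝ) * (1 - u) ^ j * ω (a * s / (a * u))) / (|a| * u))) =
      fun s => a ^ b * |a|⁻¹ * (Set.Ioi (0:ℝ)).indicator
        (fun s => ∫ u in Set.Ioo (0 : ℝ) 1, F u s) s := by
    ext s
    by_cases hs : 0 < s
    · have h0 : 0 < a * s * a := by
        have : 0 < a * a := mul_self_pos.2 ha
        nlinarith [mul_pos this hs]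
      rw [if_pos h0, Set.indicator_of_mem (show s ∈ Set.Ioi (0:ℝ) from hs), one_mul,
        mul_div_cancel_left₀ _ ha, ← mul_assoc, ← integral_const_mul, ← integral_const_mul]
      congr 1
      ext u
      simp only [F]
      rw [mul_div_mul_left _ _ ha, hN, pow_add, mul_pow, div_eq_mul_inv, mul_inv]
      ring
    · have h0 : ¬ 0 < a * s * a := by
        have : 0 < a * a := mul_self_pos.2 ha
        nlinarith [mul_nonneg this.le (sub_nonneg.2 (not_lt.1 hs))]
      rw [if_neg h0, Set.indicator_of_notMem (show s ∉ Set.Ioi (0:ℝ) from hs)]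
      simp
  rw [hpt, integral_const_mul, integral_indicator measurableSet_Ioi, ← hswap, abs_inv,
    smul_eq_mul] at hcv
  have ha' : |a| ≠ 0 := abs_ne_zero.2 ha
  have hcv2 := congrArg (fun z => |a| * z) hcv
  simp only [mul_inv_cancel_left₀ ha'] at hcv2
  rw [← hcv2, Nat.factorial_succ j]
  push_cast
  field_simp

end RMT
end
end
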